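/- arXiv:2212.09341 — 2 statements merged into one kernel-verified Lean document; each statement's English description precedes it below -/
import Mathlib

section
/- Let p be a prime such that S is p-maximal, and let λ = (l,μ,m) ∈ L₀^# ∩ P_S with ν_λ := ν_p(gcd(S₀λ)) = ν_p(m) ≥ 1. Then (1/p)·λ ∈ L₀^# ∩ P_S with ν_p(gcd(S₀·(1/p)λ)) = ν_λ − 1 = ν_p(m/p), and for all integers ν ≥ 1 and 0 ≤ t < min(ν, ν_λ): N(λ, p^ν, p^t) = p^n · N((1/p)·λ, p^{ν−1}, p^t). -/
open Matrix Complex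

namespace OEis

/-- Extension of an even Gram matrix by a hyperbolic plane:
`[[0,0,1],[0,A,0],[1,0,0]]`. -/
def hyp {m : ℕ} (A : Matrix (Fin m) (Fin m) ℤ) :
    Matrix (Fin (m + 2)) (Fin (m + 2)) ℤ := fun i j =>
  if hi0 : (i : ℕ) = 0 then (if (j : ℕ) = m + 1 then 1 else 0)
  else if him : (i : ℕ) = m + 1 then (if (j : ℕ) = 0 then 1 else 0)
  else if hj0 : (j : ℕ) = 0 then 0
  else if hjm : (j : ℕ) = m + 1 then 0
  else A ⟨(i : ℕ) - 1, by have := i.isLt; omega⟩ ⟨(j : ℕ) - 1, by have := j.isLt; omega⟩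

variable (n : ℕ) (S : Matrix (Fin n) (Fin n) ℤ)

/-- `S₀ = [[0,0,1],[0,-S,0],[1,0,0]]`. -/
def MatS0 : Matrix (Fin (n + 2)) (Fin (n + 2)) ℤ := hyp (-S)

/-- `S₁ = [[0,0,1],[0,S₀,0],[1,0,0]]`. -/
def MatS1 : Matrix (Fin (n + 4)) (Fin (n + 4)) ℤ := hyp (MatS0 n S)

/-- Bilinear form `uᵀ A v` over a field `K`. -/
def bilin {m : ℕ} (K : Type) [Field K] (A : Matrix (Fin m) (Fin m) ℤ)
    (u v : Fin m → K) : K :=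
  u ⬝ᵥ (A.map (Int.cast : ℤ → K)).mulVec v

/-- Quadratic form `Q_A(v) = vᵀAv/2` over a field `K`. -/
def quadF {m : ℕ} (K : Type) [Field K] (A : Matrix (Fin m) (Fin m) ℤ)
    (v : Fin m → K) : K := bilin K A v v / 2

/-- First component of a vector. -/
def vfirst {m : ℕ} {K : Type} (g : Fin (m + 2) → K) : K := g ⟨0, by omega⟩

/-- Last component of a vector. -/
def vlast {m : ℕ} {K : Type} (g : Fin (m + 2) → K) : K := g ⟨m + 1, by omega⟩

/-- Middle components of a vector. -/
def vmid {m : ℕ} {K : Type} (g : Fin (m + 2) → K) : Fin m → K :=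
  fun i => g ⟨(i : ℕ) + 1, by have := i.isLt; omega⟩

/-- gcd of the entries of a rational vector (via numerators). -/
def ratGcd {m : ℕ} (v : Fin m → ℚ) : ℕ :=
  Finset.gcd Finset.univ fun i => (v i).num.natAbs

/-- `v` has integral entries. -/
def inLat {m : ℕ} (v : Fin m → ℚ) : Prop := ∀ i, ∃ z : ℤ, v i = (z : ℚ)

/-- `g ∈ ℤ^m + c`. -/
def inLatShift {m : ℕ} (c g : Fin m → ℚ) : Prop := ∀ i, ∃ z : ℤ, g i - c i = (z : ℚ)

/-- Membership in the dual lattice `A⁻¹ℤ^m`, i.e. `Av` is integral. -/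
def inDual {m : ℕ} (A : Matrix (Fin m) (Fin m) ℤ) (v : Fin m → ℚ) : Prop :=
  ∀ i, ∃ z : ℤ, ((A.map (Int.cast : ℤ → ℚ)).mulVec v) i = (z : ℚ)

/-- The positive cone `P_S`. -/
def PosCone : Set (Fin (n + 2) → ℝ) :=
  {y | 0 < quadF ℝ (MatS0 n S) y ∧ 0 < y ⟨0, by omega⟩}

/-- The tube domain `H_S`. -/
def HS : Set (Fin (n + 2) → ℂ) :=
  {z | (fun i => (z i).im) ∈ PosCone n S}

/-- Automorphy factor attached to a vector:
`j(g,z) = -γ Q₀(z) + (d,z)₀ + δ` for `g = (δ,dᵀ,γ)ᵀ`. -/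
noncomputable def jay (g : Fin (n + 4) → ℚ) (z : Fin (n + 2) → ℂ) : ℂ :=
  -((vlast g : ℚ) : ℂ) * quadF ℂ (MatS0 n S) z
    + bilin ℂ (MatS0 n S) (fun i => ((vmid g i : ℚ) : ℂ)) z
    + ((vfirst g : ℚ) : ℂ)

/-- The index set of the Eisenstein series attached to a cusp `c`:
`{g ∈ L₁ + c : Q₁(g) = 0, gcd(S₁g) = 1}`. -/
def cuspSet (c : Fin (n + 4) → ℚ) : Set (Fin (n + 4) → ℚ) :=
  {g | inLatShift c g ∧ quadF ℚ (MatS1 n S) g = 0 ∧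
    ratGcd (((MatS1 n S).map (Int.cast : ℤ → ℚ)).mulVec g) = 1}

/-- The standard-form cusp vector `(1, 0, 𝔠ᵀ, 0, Q(𝔠))ᵀ`. -/
def stdCuspVec (fc : Fin n → ℚ) : Fin (n + 4) → ℚ := fun i =>
  if h0 : (i : ℕ) = 0 then 1
  else if h3 : (i : ℕ) = n + 3 then quadF ℚ S fc
  else if h12 : (i : ℕ) = 1 ∨ (i : ℕ) = n + 2 then 0
  else fc ⟨(i : ℕ) - 2, by have := i.isLt; omega⟩

/-- `c` is a standard-form cusp. -/
def IsStdCusp (c : Fin (n + 4) → ℚ) : Prop :=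
  ∃ fc : Fin n → ℚ, inDual S fc ∧ (∃ z : ℤ, quadF ℚ S fc = (z : ℚ)) ∧
    c = stdCuspVec n S fc

/-- The real orthogonal group of `A`. -/
def OSet {m : ℕ} (A : Matrix (Fin m) (Fin m) ℤ) : Set (Matrix (Fin m) (Fin m) ℝ) :=
  {M | Mᵀ * A.map (Int.cast : ℤ → ℝ) * M = A.map (Int.cast : ℤ → ℝ)}

/-- Connected component of the identity in the real orthogonal group. -/
def OPlus {m : ℕ} (A : Matrix (Fin m) (Fin m) ℤ) : Set (Matrix (Fin m) (Fin m) ℝ) :=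
  connectedComponentIn (OSet A) 1

/-- `Γ_S`: integral matrices in `O⁺(S₁;ℝ)`. -/
def GammaS : Set (Matrix (Fin (n + 4)) (Fin (n + 4)) ℝ) :=
  {M | M ∈ OPlus (MatS1 n S) ∧ ∀ i j, ∃ z : ℤ, M i j = (z : ℝ)}

/-- The discriminant kernel `Γ̃_S`. -/
def GammaTilde : Set (Matrix (Fin (n + 4)) (Fin (n + 4)) ℝ) :=
  {M | M ∈ GammaS n S ∧
    ∃ X : Matrix (Fin (n + 4)) (Fin (n + 4)) ℤ,
      M = 1 + (X * MatS1 n S).map (Int.cast : ℤ → ℝ)}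

/-- Automorphy factor of a matrix: `j(M,z) = -γ Q₀(z) + (d,z)₀ + δ`
where `(γ, dᵀS₀, δ)` is the bottom row of `M`. -/
noncomputable def jayM (M : Matrix (Fin (n + 4)) (Fin (n + 4)) ℝ)
    (z : Fin (n + 2) → ℂ) : ℂ :=
  -((M ⟨n + 3, by omega⟩ ⟨0, by omega⟩ : ℝ) : ℂ) * quadF ℂ (MatS0 n S) z
    + ∑ i : Fin (n + 2),
        ((M ⟨n + 3, by omega⟩ ⟨(i : ℕ) + 1, by have := i.isLt; omega⟩ : ℝ) : ℂ) * z i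
    + ((M ⟨n + 3, by omega⟩ ⟨n + 3, by omega⟩ : ℝ) : ℂ)

/-- The action `M⟨z⟩ = (-Q₀(z)·b + Kz + c')·j(M,z)⁻¹`. -/
noncomputable def actM (M : Matrix (Fin (n + 4)) (Fin (n + 4)) ℝ)
    (z : Fin (n + 2) → ℂ) : Fin (n + 2) → ℂ := fun i =>
  (-(quadF ℂ (MatS0 n S) z) *
      ((M ⟨(i : ℕ) + 1, by have := i.isLt; omega⟩ ⟨0, by omega⟩ : ℝ) : ℂ)
    + ∑ j : Fin (n + 2),
        ((M ⟨(i : ℕ) + 1, by have := i.isLt; omega⟩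
            ⟨(j : ℕ) + 1, by have := j.isLt; omega⟩ : ℝ) : ℂ) * z j
    + ((M ⟨(i : ℕ) + 1, by have := i.isLt; omega⟩ ⟨n + 3, by omega⟩ : ℝ) : ℂ))
  * (jayM n S M z)⁻¹

/-- The integral vector `(−Q₀(d)/γ, dᵀ, γ)ᵀ` built from `d` and `γ`. -/
def gExt (d : Fin (n + 2) → ℕ) (γ : ℕ) : Fin (n + 4) → ℚ := fun i =>
  if h0 : (i : ℕ) = 0 then -(quadF ℚ (MatS0 n S) fun j => (d j : ℚ)) / γ
  else if h3 : (i : ℕ) = n + 3 then (γ : ℚ)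
  else (d ⟨(i : ℕ) - 1, by have := i.isLt; omega⟩ : ℚ)

open scoped Classical in
/-- The Dirichlet coefficient `a(λ,γ)`. -/
noncomputable def aCoef (lam : Fin (n + 2) → ℚ) (γ : ℕ) : ℂ :=
  ∑ d ∈ Fintype.piFinset fun _ : Fin (n + 2) => Finset.range γ,
    if (∃ e : ℤ, quadF ℚ (MatS0 n S) (fun j => (d j : ℚ)) = (γ : ℚ) * e) ∧
        ratGcd (((MatS1 n S).map (Int.cast : ℤ → ℚ)).mulVec (gExt n S d γ)) = 1 then
      Complex.exp (2 * Real.pi * Complex.I *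
        ((bilin ℚ (MatS0 n S) lam (fun j => (d j : ℚ)) / γ : ℚ) : ℂ))
    else 0

/-- The convolution `b(λ,γ) = Σ_{δ∣γ} a(λ,δ)`. -/
noncomputable def bCoef (lam : Fin (n + 2) → ℚ) (γ : ℕ) : ℂ :=
  ∑ δ ∈ γ.divisors, aCoef n S lam δ

/-- The order/level of a rational vector: least `N ≥ 1` with `Nv` integral. -/
noncomputable def ordv {m : ℕ} (v : Fin m → ℚ) : ℕ :=
  sInf {N : ℕ | 0 < N ∧ ∀ i, ∃ z : ℤ, (N : ℚ) * v i = (z : ℚ)}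

/-- `S` is `p`-maximal. -/
def pMaximal (p : ℕ) : Prop :=
  ∀ v : Fin n → ℚ, inDual S v → (∃ z : ℤ, quadF ℚ S v = (z : ℚ)) → ¬ p ∣ ordv v

/-- The vector `(l, μᵀ, m)ᵀ ∈ ℚ^{n+2}`. -/
def asmVec (l : ℚ) (μ : Fin n → ℚ) (m : ℚ) : Fin (n + 2) → ℚ := fun i =>
  if h0 : (i : ℕ) = 0 then l
  else if h1 : (i : ℕ) = n + 1 then m
  else μ ⟨(i : ℕ) - 1, by have := i.isLt; omega⟩

open scoped Classical in
/-- The representation number `N(λ, p^ν, p^t)`. -/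
noncomputable def Ncount (lam : Fin (n + 2) → ℚ) (p νl ν t : ℕ) : ℕ :=
  ((Fintype.piFinset fun _ : Fin n => Finset.range (p ^ ν)).filter fun v =>
    (∃ e : ℤ, quadF ℚ S (fun i => (v i : ℚ)) = (p : ℚ) ^ (t : ℕ) * e) ∧
    (∃ e : ℤ, (p : ℚ) ^ ((νl : ℤ) - (t : ℤ)) * quadF ℚ S (fun i => (v i : ℚ))
        - bilin ℚ S (fun i => (v i : ℚ)) (vmid lam)
        + (p : ℚ) ^ ((t : ℤ) - (νl : ℤ)) * lam ⟨0, by omega⟩ * lam ⟨n + 1, by omega⟩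
      = (p : ℚ) ^ (ν : ℕ) * e)).card

/-- `N*(λ,p^ν) = Σ_{t=0}^{min(ν,ν_λ)} N(λ,p^ν,p^t)`. -/
noncomputable def Nstar (lam : Fin (n + 2) → ℚ) (p νl ν : ℕ) : ℕ :=
  ∑ t ∈ Finset.range (min ν νl + 1), Ncount n S lam p νl ν t

/-- Kloosterman sum `K(α,β;γ)` (with `β` allowed rational;
in all uses `β` is an integer). -/
noncomputable def kloos (α : ℤ) (β : ℚ) (γ : ℕ) : ℂ :=
  ∑ j ∈ Finset.range γ,
    if Nat.Coprime j γ then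
      Complex.exp (2 * Real.pi * Complex.I *
        ((((α : ℚ) * j + β * ((((j : ZMod γ)⁻¹).val : ℕ) : ℚ)) / γ : ℚ) : ℂ))
    else 0

/-- `q ≡ 0 (mod p^k)` in `ℤ_p`, for a rational `q`. -/
def pCong (p k : ℕ) (q : ℚ) : Prop :=
  q = 0 ∨ (k : ℤ) ≤ padicValRat p q

/-- The constant `c_{k,S}^• = (2π)^{2k-n/2}/(√(det S)·Γ(k)·Γ(k-n/2))`. -/
noncomputable def ckS (k : ℕ) : ℝ :=
  (2 * Real.pi) ^ ((2 * k : ℝ) - n / 2) /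
    (Real.sqrt ((S.det : ℤ) : ℝ) * Real.Gamma (k : ℝ) * Real.Gamma ((k : ℝ) - n / 2))

end OEis

open OEis

namespace OEis

section Bilinear

variable {k : ℕ} {K : Type} [Field K] (A : Matrix (Fin k) (Fin k) ℤ)

lemma bilin_smul_left (c : K) (u v : Fin k → K) :
    bilin K A (c • u) v = c * bilin K A u v := by
  simp [bilin]

lemma bilin_smul_right (c : K) (u v : Fin k → K) :
    bilin K A u (c • v) = c * bilin K A u v := by
  simp [bilin, Matrix.mulVec_smul]

lemma bilin_add_left (u v w : Fin k → K) :
    bilin K A (u + v) w = bilin K A u w + bilin K A v w := by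
  simp [bilin, add_dotProduct]

lemma bilin_add_right (u v w : Fin k → K) :
    bilin K A u (v + w) = bilin K A u v + bilin K A u w := by
  simp [bilin, Matrix.mulVec_add, dotProduct_add]

lemma bilin_comm {A : Matrix (Fin k) (Fin k) ℤ} (hA : A.IsSymm) (u v : Fin k → K) :
    bilin K A u v = bilin K A v u := by
  rw [bilin, bilin, dotProduct_comm, dotProduct_mulVec, ← mulVec_transpose, ← transpose_map,
    hA.eq, dotProduct_comm, dotProduct_comm]

lemma quadF_smul (c : K) (v : Fin k → K) : quadF K A (c • v) = c ^ 2 * quadF K A v := by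
  simp only [quadF, bilin_smul_left, bilin_smul_right]
  ring

lemma exists_bilin_eq_intCast_of_inDual {A : Matrix (Fin k) (Fin k) ℤ} {v : Fin k → ℚ}
    (hv : inDual A v) (u : Fin k → ℤ) :
    ∃ z : ℤ, bilin ℚ A (fun i => (u i : ℚ)) v = z := by
  choose z hz using hv
  exact ⟨∑ i, u i * z i, by simp [bilin, dotProduct, hz]⟩

lemma bilin_intCast (u v : Fin k → ℤ) :
    bilin ℚ A (fun i => (u i : ℚ)) (fun i => (v i : ℚ)) = ((u ⬝ᵥ A.mulVec v : ℤ) : ℚ) := by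
  simp [bilin, dotProduct, mulVec]

lemma exists_quadF_add_smul {A : Matrix (Fin k) (Fin k) ℤ} (hA : A.IsSymm)
    (heven : ∀ v : Fin k → ℤ, 2 ∣ v ⬝ᵥ A.mulVec v) (w u : Fin k → ℤ) (M : ℤ) :
    ∃ z : ℤ, quadF ℚ A ((fun i => (w i : ℚ)) + (M : ℚ) • fun i => (u i : ℚ)) =
      quadF ℚ A (fun i => (w i : ℚ)) + M * z := by
  obtain ⟨q, hq⟩ := heven u
  refine ⟨w ⬝ᵥ A.mulVec u + M * q, ?_⟩
  simp only [quadF, bilin_add_left, bilin_add_right, bilin_smul_left, bilin_smul_right,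
    bilin_comm hA (fun i => (u i : ℚ)) (fun i => (w i : ℚ))]
  simp only [bilin_intCast, hq]
  push_cast
  ring

end Bilinear

section Hyp

variable {k : ℕ} (A : Matrix (Fin k) (Fin k) ℤ) (x : Fin (k + 2) → ℚ)

lemma hyp_mulVec_zero :
    (((hyp A).map (Int.cast : ℤ → ℚ)).mulVec x) 0 = x (Fin.last (k + 1)) := by
  rw [mulVec, dotProduct, Fin.sum_univ_castSucc]
  simp [hyp, (Fin.is_lt _).ne]

lemma hyp_mulVec_last :
    (((hyp A).map (Int.cast : ℤ → ℚ)).mulVec x) (Fin.last (k + 1)) = x 0 := by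
  rw [mulVec, dotProduct, Fin.sum_univ_succ]
  simp [hyp]

lemma hyp_mulVec_mid (i : Fin k) :
    (((hyp A).map (Int.cast : ℤ → ℚ)).mulVec x) i.castSucc.succ =
      ((A.map (Int.cast : ℤ → ℚ)).mulVec (vmid x)) i := by
  rw [mulVec, dotProduct, Fin.sum_univ_succ, Fin.sum_univ_castSucc]
  simp [hyp, mulVec, dotProduct, vmid, (Fin.is_lt _).ne]
  rfl

lemma inDual_hyp_iff :
    inDual (hyp A) x ↔ (∃ z : ℤ, x 0 = z) ∧ inDual A (vmid x) ∧
      ∃ z : ℤ, x (Fin.last (k + 1)) = z := by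
  simp only [inDual]
  rw [Fin.forall_fin_succ, Fin.forall_fin_succ']
  simp only [hyp_mulVec_mid, hyp_mulVec_zero, Fin.succ_last, hyp_mulVec_last]
  tauto

lemma inDual_neg_iff {v : Fin k → ℚ} : inDual (-A) v ↔ inDual A v := by
  have h : (-A).map (Int.cast : ℤ → ℚ) = -A.map (Int.cast : ℤ → ℚ) := by ext; simp
  simp only [inDual, h, neg_mulVec, Pi.neg_apply]
  refine forall_congr' fun i => ⟨?_, ?_⟩ <;>
  · rintro ⟨z, hz⟩
    exact ⟨-z, by push_cast; linarith⟩

end Hyp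

lemma ratGcd_natCast_mul {k : ℕ} (p : ℕ) (z : Fin k → ℤ) :
    ratGcd (fun i => (p : ℚ) * z i) = p * ratGcd (fun i => (z i : ℚ)) := by
  have h (i : Fin k) : ((p : ℚ) * z i).num.natAbs = p * (z i).natAbs := by
    rw [show ((p : ℚ) * z i) = ((p * z i : ℤ) : ℚ) by push_cast; rfl, Rat.num_intCast,
      Int.natAbs_mul, Int.natAbs_natCast]
  simp only [ratGcd, h, Finset.gcd_mul_left, Rat.num_intCast, normalize_eq]

lemma ratGcd_dvd {k : ℕ} (z : Fin k → ℤ) (i : Fin k) :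
    (ratGcd (fun i => (z i : ℚ)) : ℤ) ∣ z i := by
  rw [Int.natCast_dvd]
  simpa [ratGcd] using Finset.gcd_dvd (f := fun i => ((z i : ℚ)).num.natAbs) (Finset.mem_univ i)

/-- A condition on vectors that is periodic modulo `M` is satisfied `k ^ n` times as often
modulo `M * k` as modulo `M`. -/
lemma card_filter_piFinset_range_mul {n M k : ℕ} (hM : 0 < M) (P : (Fin n → ℕ) → Prop)
    [DecidablePred P] (hP : ∀ v : Fin n → ℕ, P v ↔ P fun i => v i % M) :
    ((Fintype.piFinset fun _ : Fin n => Finset.range (M * k)).filter P).card =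
      k ^ n * ((Fintype.piFinset fun _ : Fin n => Finset.range M).filter P).card := by
  have hk : k ^ n = (Fintype.piFinset fun _ : Fin n => Finset.range k).card := by simp
  rw [hk, ← Finset.card_product]
  refine Finset.card_nbij' (fun v => (fun i => v i / M, fun i => v i % M))
    (fun a i => a.2 i + M * a.1 i) ?_ ?_ ?_ ?_
  · intro v hv
    simp only [Finset.coe_filter, Fintype.mem_piFinset, Finset.mem_range, Set.mem_ofPred_eq] at hv
    simp only [Finset.coe_product, Set.mem_prod, Finset.mem_coe, Finset.mem_filter,
      Fintype.mem_piFinset, Finset.mem_range]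
    exact ⟨fun i => Nat.div_lt_of_lt_mul (hv.1 i), fun i => Nat.mod_lt _ hM, (hP v).1 hv.2⟩
  · rintro ⟨q, r⟩ h
    simp only [Finset.coe_product, Set.mem_prod, Finset.mem_coe, Finset.mem_filter,
      Fintype.mem_piFinset, Finset.mem_range] at h
    simp only [Finset.coe_filter, Fintype.mem_piFinset, Finset.mem_range, Set.mem_ofPred_eq]
    refine ⟨fun i => ?_, ?_⟩
    · have := Nat.mul_le_mul_left M (h.1 i)
      have := h.2.1 i
      rw [Nat.mul_succ] at *
      omega
    · rw [hP]
      convert h.2.2 using 2 with i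
      simp [Nat.mod_eq_of_lt (h.2.1 i)]
  · intro v _
    exact funext fun i => Nat.mod_add_div _ _
  · rintro ⟨q, r⟩ h
    simp only [Finset.coe_product, Set.mem_prod, Finset.mem_coe, Finset.mem_filter,
      Fintype.mem_piFinset, Finset.mem_range] at h
    refine Prod.ext (funext fun i => ?_) (funext fun i => ?_)
    · simp [Nat.add_mul_div_left _ _ hM, Nat.div_eq_of_lt (h.2.1 i)]
    · simp [Nat.mod_eq_of_lt (h.2.1 i)]

lemma exists_eq_mul_intCast_congr {a b M : ℚ} {z : ℤ} (h : a = b + M * z) :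
    (∃ e : ℤ, a = M * e) ↔ ∃ e : ℤ, b = M * e := by
  constructor <;> rintro ⟨e, he⟩
  · exact ⟨e - z, by push_cast; linarith⟩
  · exact ⟨e + z, by push_cast; linarith⟩

/-- The representation number for modulus `p ^ (ν + 1)` in terms of the one for `p ^ ν`
and the vector divided by `p`. -/
lemma Ncount_succ_succ {n : ℕ} {S : Matrix (Fin n) (Fin n) ℤ} (hS : S.IsSymm)
    (heven : ∀ v : Fin n → ℤ, 2 ∣ v ⬝ᵥ S.mulVec v) {p : ℕ} (hp : 0 < p)
    {lam : Fin (n + 2) → ℚ} (hlam : inDual S (vmid fun i => lam i / p))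
    {κ ν t : ℕ} (htν : t ≤ ν) (htκ : t ≤ κ) :
    Ncount n S lam p (κ + 1) (ν + 1) t =
      p ^ n * Ncount n S (fun i => lam i / p) p κ ν t := by
  classical
  have hp0 : (p : ℚ) ≠ 0 := by positivity
  have hmid : vmid lam = (p : ℚ) • vmid fun i => lam i / p := by
    ext i
    simp [vmid, mul_div_cancel₀ _ hp0]
  rw [Ncount, Ncount, ← card_filter_piFinset_range_mul (by positivity), ← pow_succ]
  · congr 1
    refine Finset.filter_congr fun v _ => and_congr_right fun _ => exists_congr fun e => ?_
    have h1 : (p : ℚ) ^ (((κ + 1 : ℕ) : ℤ) - (t : ℤ)) = p * (p : ℚ) ^ ((κ : ℤ) - t) := by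
      rw [← zpow_one_add₀ hp0]
      congr 1
      push_cast
      ring
    have h2 : (p : ℚ) ^ ((t : ℤ) - ((κ + 1 : ℕ) : ℤ)) = (p : ℚ) ^ ((t : ℤ) - κ) / p := by
      rw [div_eq_mul_inv, ← zpow_sub_one₀ hp0]
      congr 1
      push_cast
      ring
    refine Iff.trans ?_ (mul_right_inj' hp0)
    rw [h1, h2, hmid, bilin_smul_right]
    refine Eq.congr ?_ ?_
    · field_simp
    · ring
  · intro v
    obtain ⟨z, hz⟩ := exists_quadF_add_smul hS heven (fun i => (v i % p ^ ν : ℕ))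
      (fun i => (v i / p ^ ν : ℕ)) (p ^ ν : ℕ)
    obtain ⟨y, hy⟩ := exists_bilin_eq_intCast_of_inDual hlam fun i => (v i / p ^ ν : ℕ)
    simp only [Int.cast_natCast] at hz hy
    have hv : (fun i => (v i : ℚ)) = (fun i => ((v i % p ^ ν : ℕ) : ℚ)) +
        ((p ^ ν : ℕ) : ℚ) • fun i => ((v i / p ^ ν : ℕ) : ℚ) := by
      ext i
      simp only [Pi.add_apply, Pi.smul_apply, smul_eq_mul]
      exact_mod_cast (Nat.mod_add_div _ _).symm
    refine and_congr (exists_eq_mul_intCast_congr (z := p ^ (ν - t) * z) ?_)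
      (exists_eq_mul_intCast_congr (z := p ^ (κ - t) * z - y) ?_)
    · rw [hv, hz, ← Nat.add_sub_of_le htν]
      push_cast
      simp only [Nat.add_sub_cancel_left]
      ring
    · rw [hv, hz, bilin_add_left, bilin_smul_left, hy, ← Nat.cast_sub htκ, zpow_natCast]
      push_cast
      ring

end OEis

/-- division of `λ` by `p` and the corresponding relation
`N(λ,p^ν,p^t) = p^n · N(λ/p, p^{ν−1}, p^t)` for `t < min(ν,ν_λ)`. -/
theorem representation_number_divide_by_p
    (n : ℕ) (hn : 1 ≤ n) (S : Matrix (Fin n) (Fin n) ℤ)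
    (hsymm : S.IsSymm)
    (hpos : ∀ v : Fin n → ℝ, v ≠ 0 → 0 < bilin ℝ S v v)
    (heven : ∀ v : Fin n → ℤ, 2 ∣ v ⬝ᵥ S.mulVec v)
    (p : ℕ) (hp : p.Prime) (hmax : pMaximal n S p)
    (l : ℤ) (μ : Fin n → ℚ) (hμ : inDual S μ) (m : ℤ)
    (lam : Fin (n + 2) → ℚ) (hlamdef : lam = asmVec n (l : ℚ) μ (m : ℚ))
    (hlampos : (fun i => ((lam i : ℚ) : ℝ)) ∈ PosCone n S)
    (νl : ℕ)
    (hνl : νl = padicValNat p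
      (ratGcd (((MatS0 n S).map (Int.cast : ℤ → ℚ)).mulVec lam)))
    (hνlm : νl = padicValInt p m)
    (hνl1 : 1 ≤ νl) :
    inDual (MatS0 n S) (fun i => lam i / p) ∧
    (fun i => ((lam i / p : ℚ) : ℝ)) ∈ PosCone n S ∧
    padicValNat p
        (ratGcd (((MatS0 n S).map (Int.cast : ℤ → ℚ)).mulVec fun i => lam i / p))
      = νl - 1 ∧
    padicValInt p (m / p) = νl - 1 ∧
    (∀ ν t : ℕ, 1 ≤ ν → t < min ν νl →
      Ncount n S lam p νl ν t
        = p ^ n * Ncount n S (fun i => lam i / p) p (νl - 1) (ν - 1) t) := by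
  have hpQ : (p : ℚ) ≠ 0 := by exact_mod_cast hp.ne_zero
  have hpR : (0 : ℝ) < p := by exact_mod_cast hp.pos
  have := Fact.mk hp
  have hdiv : (fun i => lam i / p) = (p : ℚ)⁻¹ • lam := by
    ext i
    simp [div_eq_inv_mul]
  have hmid : vmid lam = μ := by
    ext i
    simp [hlamdef, vmid, asmVec, i.isLt.ne]
  have hdual : inDual (MatS0 n S) lam := by
    rw [MatS0, inDual_hyp_iff, inDual_neg_iff, hmid]
    exact ⟨⟨l, by simp [hlamdef, asmVec]⟩, hμ, ⟨m, by simp [hlamdef, asmVec]⟩⟩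
  choose y hy using hdual
  have hy' : ((MatS0 n S).map (Int.cast : ℤ → ℚ)).mulVec lam = fun i => (y i : ℚ) := funext hy
  rw [hy'] at hνl
  have hpdvd (i) : (p : ℤ) ∣ y i :=
    (Int.natCast_dvd_natCast.2 (dvd_of_one_le_padicValNat (hνl ▸ hνl1))).trans (ratGcd_dvd y i)
  choose z hz using hpdvd
  have hquot : (((MatS0 n S).map (Int.cast : ℤ → ℚ)).mulVec fun i => lam i / p) =
      fun i => (z i : ℚ) := by
    rw [hdiv, mulVec_smul, hy']
    ext i
    simp [hz, hpQ]
  have hdualdiv : inDual (MatS0 n S) (fun i => lam i / p) := fun i => ⟨z i, congrFun hquot i⟩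
  refine ⟨hdualdiv, ⟨?_, ?_⟩, ?_, ?_, ?_⟩
  · have hcast : (fun i => ((lam i / p : ℚ) : ℝ)) = (p : ℝ)⁻¹ • fun i => (lam i : ℝ) := by
      ext i
      simp [div_eq_inv_mul]
    rw [hcast, quadF_smul]
    exact mul_pos (by positivity) hlampos.1
  · push_cast
    exact div_pos hlampos.2 hpR
  · have hgcd : ratGcd (fun i => (y i : ℚ)) = p * ratGcd (fun i => (z i : ℚ)) := by
      rw [← ratGcd_natCast_mul]
      simp [hz]
    have hne : ratGcd (fun i => (z i : ℚ)) ≠ 0 := by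
      intro h0
      rw [hgcd, h0, mul_zero, padicValNat_zero_right] at hνl
      omega
    rw [hquot, hνl, hgcd, padicValNat.mul hp.ne_zero hne, padicValNat.self hp.one_lt,
      Nat.add_sub_cancel_left]
  · have hpm : (p : ℤ) ∣ m := by
      rw [Int.natCast_dvd]
      exact dvd_of_one_le_padicValNat (hνl1.trans_eq hνlm)
    rw [padicValInt, Int.natAbs_ediv_of_dvd hpm, Int.natAbs_natCast,
      padicValNat.div (Int.natCast_dvd.1 hpm), hνlm, padicValInt]
  · intro ν t hν ht
    obtain ⟨κ, rfl⟩ := Nat.exists_eq_add_of_le' hνl1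
    obtain ⟨ν, rfl⟩ := Nat.exists_eq_add_of_le' hν
    rw [MatS0, inDual_hyp_iff, inDual_neg_iff] at hdualdiv
    exact Ncount_succ_succ hsymm heven hp.pos hdualdiv.2.1 (by omega) (by omega)
end

section
/- Let p be a prime such that S is p-maximal, and let λ = (l, μ, p^{ν_λ}·m) ∈ L₀^# ∩ P_S with p ∤ m and ν_λ := ν_p(gcd(S₀λ)) ≥ 1. Put λ* := (p^{ν_λ}·l, μ, m) ∈ L₀^# ∩ P_S. Then for every integer ν ≥ 1: N*(λ, p^ν) = N*(λ*, p^ν) + p^n · N*((1/p)·λ, p^{ν−1}). (This is the identity underlying the fact that the Eisenstein series attached to the standard cusp satisfies the local Maaß condition at every prime p at which the lattice is maximal.) -/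
open Matrix Complex

open OEis

/-- The integral quadratic form `vᵀSv/2` of an even matrix. -/
def halfForm {n : ℕ} (S : Matrix (Fin n) (Fin n) ℤ) (v : Fin n → ℤ) : ℤ :=
  (v ⬝ᵥ S.mulVec v) / 2

theorem quadF_intCast {n : ℕ} {S : Matrix (Fin n) (Fin n) ℤ}
    (heven : ∀ v : Fin n → ℤ, 2 ∣ v ⬝ᵥ S.mulVec v) (v : Fin n → ℤ) :
    quadF ℚ S (fun i => (v i : ℚ)) = halfForm S v := by
  have h : (2 * halfForm S v : ℤ) = v ⬝ᵥ S.mulVec v := Int.mul_ediv_cancel' (heven v)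
  have h' : bilin ℚ S (fun i => (v i : ℚ)) (fun i => (v i : ℚ)) = 2 * halfForm S v := by
    have := congrArg (Int.cast : ℤ → ℚ) h
    push_cast at this
    rw [this]
    simp [bilin, dotProduct, mulVec]
  rw [quadF, h']
  ring

theorem halfForm_add_mul {n : ℕ} {S : Matrix (Fin n) (Fin n) ℤ} (hsymm : S.IsSymm)
    (heven : ∀ v : Fin n → ℤ, 2 ∣ v ⬝ᵥ S.mulVec v) (v w : Fin n → ℤ) (c : ℤ) :
    halfForm S (v + c • w) = halfForm S v + c * (v ⬝ᵥ S.mulVec w + c * halfForm S w) := by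
  have h (u : Fin n → ℤ) : 2 * halfForm S u = u ⬝ᵥ S.mulVec u :=
    Int.mul_ediv_cancel' (heven u)
  have hc : w ⬝ᵥ S.mulVec v = v ⬝ᵥ S.mulVec w := by
    rw [dotProduct_mulVec, ← mulVec_transpose, hsymm.eq, dotProduct_comm]
  have h1 := h (v + c • w)
  simp only [mulVec_add, mulVec_smul, add_dotProduct, dotProduct_add, smul_dotProduct,
    dotProduct_smul, smul_eq_mul, hc, ← h v, ← h w] at h1
  linarith

/-- The congruence conditions counted by `Ncount`, expressed over `ℤ`. -/
def RepCond {n : ℕ} (S : Matrix (Fin n) (Fin n) ℤ) (w : Fin n → ℤ) (d p : ℤ)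
    (a ν t : ℕ) (v : Fin n → ℤ) : Prop :=
  p ^ t ∣ halfForm S v ∧ p ^ ν ∣ p ^ (a - t) * halfForm S v - v ⬝ᵥ w + d

open scoped Classical in
theorem Ncount_eq_card {n : ℕ} {S : Matrix (Fin n) (Fin n) ℤ}
    (heven : ∀ v : Fin n → ℤ, 2 ∣ v ⬝ᵥ S.mulVec v) {lam : Fin (n + 2) → ℚ}
    {p a ν t : ℕ} (ht : t ≤ a) {w : Fin n → ℤ} {d : ℤ}
    (hw : (S.map (Int.cast : ℤ → ℚ)).mulVec (vmid lam) = fun i => (w i : ℚ))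
    (hd : (p : ℚ) ^ ((t : ℤ) - (a : ℤ)) * lam ⟨0, by omega⟩ * lam ⟨n + 1, by omega⟩ = d) :
    Ncount n S lam p a ν t =
      ((Fintype.piFinset fun _ : Fin n => Finset.range (p ^ ν)).filter fun v =>
        RepCond S w d p a ν t (fun i => (v i : ℤ))).card := by
  unfold Ncount
  congr 1
  refine Finset.filter_congr fun v _ => ?_
  have hq := quadF_intCast heven (fun i => (v i : ℤ))
  have hb : bilin ℚ S (fun i => (v i : ℚ)) (vmid lam) =
      (((fun i => (v i : ℤ)) ⬝ᵥ w : ℤ) : ℚ) := by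
    rw [bilin, hw]
    simp [dotProduct]
  simp only [Int.cast_natCast] at hq
  rw [hd, hq, hb, ← Nat.cast_sub ht, zpow_natCast, RepCond]
  refine and_congr (exists_congr fun e => ?_) (exists_congr fun e => ?_) <;> norm_cast

theorem RepCond.add_mul_iff {n : ℕ} {S : Matrix (Fin n) (Fin n) ℤ} (hsymm : S.IsSymm)
    (heven : ∀ v : Fin n → ℤ, 2 ∣ v ⬝ᵥ S.mulVec v) {w : Fin n → ℤ} {d p : ℤ}
    {a k t : ℕ} (ht : t ≤ k) (v u : Fin n → ℤ) :
    RepCond S w d p a k t (v + p ^ k • u) ↔ RepCond S w d p a k t v := by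
  unfold RepCond
  rw [halfForm_add_mul hsymm heven, add_dotProduct, smul_dotProduct, smul_eq_mul]
  generalize v ⬝ᵥ S.mulVec u + p ^ k * halfForm S u = x
  refine and_congr (dvd_add_left ((pow_dvd_pow p ht).mul_right x)) ?_
  rw [show p ^ (a - t) * (halfForm S v + p ^ k * x) - (v ⬝ᵥ w + p ^ k * (u ⬝ᵥ w)) + d =
      (p ^ (a - t) * halfForm S v - v ⬝ᵥ w + d) + p ^ k * (p ^ (a - t) * x - u ⬝ᵥ w) by ring]
  exact dvd_add_left (dvd_mul_right _ _)

theorem RepCond.mul_succ_iff {n : ℕ} {S : Matrix (Fin n) (Fin n) ℤ} {w : Fin n → ℤ} {d p : ℤ}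
    (hp : p ≠ 0) {a k t : ℕ} (ht : t ≤ a) (v : Fin n → ℤ) :
    RepCond S (p • w) (p * d) p (a + 1) (k + 1) t v ↔ RepCond S w d p a k t v := by
  unfold RepCond
  rw [dotProduct_smul, smul_eq_mul, Nat.succ_sub ht, pow_succ', pow_succ',
    show p * p ^ (a - t) * halfForm S v - p * (v ⬝ᵥ w) + p * d =
      p * (p ^ (a - t) * halfForm S v - v ⬝ᵥ w + d) by ring, mul_dvd_mul_iff_left hp]

open scoped Classical in
theorem card_filter_piFinset_range_mul {n q p : ℕ} (hq : 0 < q)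
    (P : (Fin n → ℕ) → Prop) (hP : ∀ v u : Fin n → ℕ, P (v + q • u) ↔ P v) :
    ((Fintype.piFinset fun _ : Fin n => Finset.range (q * p)).filter P).card =
      p ^ n * ((Fintype.piFinset fun _ : Fin n => Finset.range q).filter P).card := by
  have hc : (Fintype.piFinset fun _ : Fin n => Finset.range p).card = p ^ n := by simp
  rw [← hc, ← Finset.card_product]
  refine Finset.card_nbij' (fun v => (fun i => v i / q, fun i => v i % q))
    (fun x => x.2 + q • x.1) ?_ ?_ ?_ ?_
  · intro v hv
    simp only [Finset.coe_filter, Fintype.mem_piFinset, Finset.mem_range, Set.mem_ofPred_eq,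
      Finset.coe_product, Set.mem_prod, Finset.mem_coe] at hv ⊢
    refine ⟨fun i => Nat.div_lt_of_lt_mul (hv.1 i), fun i => Nat.mod_lt _ hq, ?_⟩
    rw [← hP _ (fun i => v i / q)]
    convert hv.2 using 1
    ext i
    simp [Nat.mod_add_div]
  · rintro ⟨u, v⟩ hx
    simp only [Finset.coe_filter, Fintype.mem_piFinset, Finset.mem_range, Set.mem_ofPred_eq,
      Finset.coe_product, Set.mem_prod, Finset.mem_coe] at hx ⊢
    refine ⟨fun i => ?_, (hP v u).2 hx.2.2⟩
    have h1 := hx.1 i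
    have h2 := hx.2.1 i
    simp only [Pi.add_apply, Pi.smul_apply, smul_eq_mul]
    nlinarith
  · intro v _
    ext i
    simp [Nat.mod_add_div]
  · rintro ⟨u, v⟩ hx
    simp only [Finset.coe_filter, Fintype.mem_piFinset, Finset.mem_range, Set.mem_ofPred_eq,
      Finset.coe_product, Set.mem_prod, Finset.mem_coe] at hx
    ext i
    · simp [Nat.add_mul_div_left _ _ hq, Nat.div_eq_of_lt (hx.2.1 i)]
    · simp [Nat.mod_eq_of_lt (hx.2.1 i)]

open scoped Classical in
theorem card_repCond_mul_succ {n : ℕ} {S : Matrix (Fin n) (Fin n) ℤ} (hsymm : S.IsSymm)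
    (heven : ∀ v : Fin n → ℤ, 2 ∣ v ⬝ᵥ S.mulVec v) {w : Fin n → ℤ} {d : ℤ} {p : ℕ}
    (hp : 0 < p) {a k t : ℕ} (hta : t ≤ a) (htk : t ≤ k) :
    ((Fintype.piFinset fun _ : Fin n => Finset.range (p ^ (k + 1))).filter fun v =>
        RepCond S ((p : ℤ) • w) (p * d) p (a + 1) (k + 1) t (fun i => (v i : ℤ))).card =
      p ^ n * ((Fintype.piFinset fun _ : Fin n => Finset.range (p ^ k)).filter fun v =>
        RepCond S w d p a k t (fun i => (v i : ℤ))).card := by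
  simp only [RepCond.mul_succ_iff (Int.natCast_ne_zero.2 hp.ne') hta]
  rw [pow_succ]
  refine card_filter_piFinset_range_mul (pow_pos hp k) _ fun v u => ?_
  rw [← RepCond.add_mul_iff hsymm heven htk (fun i => (v i : ℤ)) (fun i => (u i : ℤ))]
  congr! 1

theorem RepCond.min_iff {n : ℕ} {S : Matrix (Fin n) (Fin n) ℤ} {w : Fin n → ℤ} {d p : ℤ}
    {a ν : ℕ} (v : Fin n → ℤ) :
    RepCond S (p ^ a • w) (p ^ (a + min ν a) * d) p a ν (min ν a) v ↔
      RepCond S (p ^ a • w) (p ^ (a + a) * d) p 0 ν 0 v := by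
  unfold RepCond
  simp only [dotProduct_smul, smul_eq_mul, pow_zero, one_mul, Nat.sub_zero, one_dvd, true_and]
  rcases le_total a ν with h | h
  · rw [min_eq_right h, Nat.sub_self, pow_zero, one_mul, and_iff_right_iff_imp]
    intro hv
    have h1 := (pow_dvd_pow p h).trans hv
    rw [pow_add, show halfForm S v - p ^ a * (v ⬝ᵥ w) + p ^ a * p ^ a * d =
      halfForm S v + p ^ a * (p ^ a * d - v ⬝ᵥ w) by ring] at h1
    exact (dvd_add_left (dvd_mul_right _ _)).1 h1
  · have hd : p ^ ν ∣ p ^ a := pow_dvd_pow p h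
    rw [min_eq_left h, pow_add, pow_add,
      show halfForm S v - p ^ a * (v ⬝ᵥ w) + p ^ a * p ^ a * d =
        halfForm S v + p ^ a * (p ^ a * d - v ⬝ᵥ w) by ring,
      dvd_add_left (hd.mul_right _), and_iff_left_iff_imp]
    intro hv
    rw [show p ^ (a - ν) * halfForm S v - p ^ a * (v ⬝ᵥ w) + p ^ a * p ^ ν * d =
        p ^ (a - ν) * halfForm S v + p ^ a * (p ^ ν * d - v ⬝ᵥ w) by ring]
    exact dvd_add (hv.mul_left _) (hd.mul_right _)

theorem vmid_asmVec {n : ℕ} (l : ℚ) (μ : Fin n → ℚ) (m : ℚ) : vmid (asmVec n l μ m) = μ := by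
  ext i
  simp [vmid, asmVec, i.isLt.ne]

theorem asmVec_first {n : ℕ} (l : ℚ) (μ : Fin n → ℚ) (m : ℚ) :
    asmVec n l μ m ⟨0, by omega⟩ = l := by
  simp [asmVec]

theorem asmVec_last {n : ℕ} (l : ℚ) (μ : Fin n → ℚ) (m : ℚ) :
    asmVec n l μ m ⟨n + 1, by omega⟩ = m := by
  simp [asmVec]

theorem matS0_mulVec_asmVec_last {n : ℕ} (S : Matrix (Fin n) (Fin n) ℤ)
    (l : ℚ) (μ : Fin n → ℚ) (m : ℚ) :
    ((MatS0 n S).map (Int.cast : ℤ → ℚ)).mulVec (asmVec n l μ m) (Fin.last (n + 1)) = l := by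
  simp [mulVec, dotProduct, Fin.sum_univ_succ, MatS0, hyp, asmVec]

theorem matS0_mulVec_asmVec_mid {n : ℕ} (S : Matrix (Fin n) (Fin n) ℤ)
    (l : ℚ) (μ : Fin n → ℚ) (m : ℚ) (i : Fin n) :
    ((MatS0 n S).map (Int.cast : ℤ → ℚ)).mulVec (asmVec n l μ m) i.castSucc.succ =
      -(S.map (Int.cast : ℤ → ℚ)).mulVec μ i := by
  rw [mulVec, dotProduct, Fin.sum_univ_succ, Fin.sum_univ_castSucc]
  simp [mulVec, dotProduct, MatS0, hyp, asmVec, i.isLt.ne, (Fin.isLt _).ne]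

theorem natCast_pow_dvd_of_ratGcd {m p a : ℕ} {v : Fin m → ℚ}
    (h : a = padicValNat p (ratGcd v)) {i : Fin m} {z : ℤ} (hz : v i = z) :
    (p : ℤ) ^ a ∣ z := by
  have h1 : p ^ a ∣ ratGcd v := h ▸ pow_padicValNat_dvd
  have h2 : p ^ a ∣ (v i).num.natAbs := h1.trans (Finset.gcd_dvd (Finset.mem_univ i))
  rw [hz, Rat.num_intCast] at h2
  exact_mod_cast Int.natCast_dvd.2 h2

/-- the local Maaß identity for the representation numbers:
`N*(λ,p^ν) = N*(λ*,p^ν) + p^n N*((1/p)λ, p^{ν−1})`. -/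
theorem representation_number_local_maass
    (n : ℕ) (hn : 1 ≤ n) (S : Matrix (Fin n) (Fin n) ℤ)
    (hsymm : S.IsSymm)
    (hpos : ∀ v : Fin n → ℝ, v ≠ 0 → 0 < bilin ℝ S v v)
    (heven : ∀ v : Fin n → ℤ, 2 ∣ v ⬝ᵥ S.mulVec v)
    (p : ℕ) (hp : p.Prime) (hmax : pMaximal n S p)
    (l : ℤ) (μ : Fin n → ℚ) (hμ : inDual S μ) (m : ℤ) (hm : ¬ (p : ℤ) ∣ m)
    (νl : ℕ) (hνl1 : 1 ≤ νl)
    (lam : Fin (n + 2) → ℚ)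
    (hlamdef : lam = asmVec n (l : ℚ) μ ((p : ℚ) ^ νl * m))
    (hlampos : (fun i => ((lam i : ℚ) : ℝ)) ∈ PosCone n S)
    (hνl : νl = padicValNat p
      (ratGcd (((MatS0 n S).map (Int.cast : ℤ → ℚ)).mulVec lam)))
    (ν : ℕ) (hν : 1 ≤ ν) :
    Nstar n S lam p νl ν
      = Nstar n S (asmVec n ((p : ℚ) ^ νl * l) μ (m : ℚ)) p 0 ν
        + p ^ n * Nstar n S (fun i => lam i / p) p (νl - 1) (ν - 1) := by
  classical
  obtain ⟨a, rfl⟩ : ∃ a, νl = a + 1 := ⟨νl - 1, by omega⟩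
  obtain ⟨k, rfl⟩ : ∃ k, ν = k + 1 := ⟨ν - 1, by omega⟩
  subst hlamdef
  have hp0 : (p : ℚ) ≠ 0 := Nat.cast_ne_zero.2 hp.ne_zero
  obtain ⟨l', rfl⟩ := natCast_pow_dvd_of_ratGcd hνl (matS0_mulVec_asmVec_last S _ μ _)
  choose z hz using hμ
  have hdvd (i : Fin n) : (p : ℤ) ^ (a + 1) ∣ z i := by
    have := natCast_pow_dvd_of_ratGcd hνl (z := -z i)
      ((matS0_mulVec_asmVec_mid S _ μ _ i).trans (by rw [hz]; push_cast; rfl))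
    exact (dvd_neg).1 this
  choose w hw using hdvd
  have hSμ : (S.map (Int.cast : ℤ → ℚ)).mulVec μ =
      fun i => (((p : ℤ) ^ (a + 1) • w) i : ℚ) := by
    ext i
    rw [hz, hw]
    simp
  have hSμ' : (S.map (Int.cast : ℤ → ℚ)).mulVec (vmid fun i => asmVec n
      (((p : ℤ) ^ (a + 1) * l' : ℤ) : ℚ) μ ((p : ℚ) ^ (a + 1) * m) i / p) =
        fun i => (((p : ℤ) ^ a • w) i : ℚ) := by
    have : (vmid fun i => asmVec n
        (((p : ℤ) ^ (a + 1) * l' : ℤ) : ℚ) μ ((p : ℚ) ^ (a + 1) * m) i / p) =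
          (p : ℚ)⁻¹ • μ := by
      conv_rhs => rw [← vmid_asmVec (((p : ℤ) ^ (a + 1) * l' : ℤ) : ℚ) μ ((p : ℚ) ^ (a + 1) * m)]
      ext i
      simp only [vmid, Pi.smul_apply, smul_eq_mul]
      ring
    rw [this, mulVec_smul, hSμ]
    ext i
    simp only [Pi.smul_apply, smul_eq_mul]
    push_cast
    field_simp
    ring
  have hlam (t : ℕ) (ht : t ≤ a + 1) := Ncount_eq_card heven (p := p) (ν := k + 1) ht
    (lam := asmVec n (((p : ℤ) ^ (a + 1) * l' : ℤ) : ℚ) μ ((p : ℚ) ^ (a + 1) * m))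
    (d := (p : ℤ) ^ (a + 1 + t) * (l' * m)) ((congrArg _ (vmid_asmVec _ _ _)).trans hSμ) (by
      rw [asmVec_first, asmVec_last, zpow_sub₀ hp0, zpow_natCast, zpow_natCast]
      push_cast
      field_simp
      ring)
  have hstar := Ncount_eq_card heven (p := p) (ν := k + 1) (le_refl 0)
    (lam := asmVec n ((p : ℚ) ^ (a + 1) * (((p : ℤ) ^ (a + 1) * l' : ℤ) : ℚ)) μ (m : ℚ))
    (d := (p : ℤ) ^ (a + 1 + (a + 1)) * (l' * m))
    ((congrArg _ (vmid_asmVec _ _ _)).trans hSμ) (by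
      rw [asmVec_first, asmVec_last]
      push_cast
      simp
      ring)
  have hdiv (t : ℕ) (ht : t ≤ a) := Ncount_eq_card heven (p := p) (ν := k) ht
    (d := (p : ℤ) ^ (a + t) * (l' * m)) hSμ' (by
      rw [asmVec_first, asmVec_last, zpow_sub₀ hp0, zpow_natCast, zpow_natCast]
      push_cast
      field_simp
      ring)
  have hmin := hlam (min (k + 1) (a + 1)) (min_le_right _ _)
  simp only [RepCond.min_iff, ← hstar] at hmin
  unfold Nstar
  simp only [Nat.add_sub_cancel]
  rw [Finset.sum_range_succ, hmin, Nat.min_zero, zero_add, Finset.sum_range_one, add_comm,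
    Nat.succ_min_succ, Finset.mul_sum]
  congr 1
  refine Finset.sum_congr rfl fun t ht => ?_
  rw [Finset.mem_range, Nat.lt_succ_iff, le_min_iff] at ht
  rw [hlam t (by omega), hdiv t ht.2,
    ← card_repCond_mul_succ hsymm heven hp.pos ht.2 ht.1, smul_smul, ← pow_succ']
  ring_nf
end
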